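/- (Existence Theorem) Assume d_min ≥ d_close + d_open. Let TrackStatus : Tracks × [0,∞) → {empty, coming, incrossing} be any function satisfying the train motion and piecewise-constancy requirements. Then there exist functions Deadline : Tracks × [0,∞) → ℝ ∪ {∞}, Dir : [0,∞) → {open, close}, and GateStatus : [0,∞) → {opened, closed} such that (TrackStatus, Deadline, Dir, GateStatus) is a regular run, i.e., the piecewise constancy, initial state, immediate controller, and gate conditions all hold. -/

import Mathlib

namespace RailCross

inductive TStat : Type
  | emp | coming | incrossing
deriving DecidableEq

inductive DirV : Type
  | opn | cls
deriving DecidableEq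

inductive GateV : Type
  | opened | closed
deriving DecidableEq

/-- `f` is piecewise constant on `[0, ∞)`: for every `τ > 0` there is a finite
partition `0 = s 0 < s 1 < … < s n = τ` such that `f` is constant on each open
subinterval `(s i, s (i+1))`. -/
def PWC {Y : Type*} (f : ℝ → Y) : Prop :=
  ∀ τ : ℝ, 0 < τ → ∃ n : ℕ, ∃ s : ℕ → ℝ,
    s 0 = 0 ∧ s n = τ ∧ (∀ i < n, s i < s (i + 1)) ∧
    (∀ i < n, ∀ a b : ℝ, s i < a → a < b → b < s (i + 1) → f a = f b)

/-- `v` is the right-hand value `f(t+)`: `f` is constantly `v` on some `(t, t+ε)`. -/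
def RightVal {Y : Type*} (f : ℝ → Y) (t : ℝ) (v : Y) : Prop :=
  ∃ ε : ℝ, 0 < ε ∧ ∀ u : ℝ, t < u → u < t + ε → f u = v

/-- `v` is the left-hand value `f(t−)` (for `t > 0`): `f` is constantly `v` on some `(t-ε, t)`. -/
def LeftVal {Y : Type*} (f : ℝ → Y) (t : ℝ) (v : Y) : Prop :=
  ∃ ε : ℝ, 0 < ε ∧ ε ≤ t ∧ ∀ u : ℝ, t - ε < u → u < t → f u = v

/-- `tm` is the (finite or infinite) increasing sequence of significant moments of a
track with status function `f`; a finite sequence is encoded by letting `tm` take the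
value `⊤ = ∞` from some point on. -/
structure TrainMotion (dmin dmax : ℝ) (f : ℝ → TStat) (tm : ℕ → EReal) : Prop where
  zero : tm 0 = 0
  mono : Monotone tm
  strict : ∀ i, tm i ≠ ⊤ → tm i < tm (i + 1)
  last_div : ∀ k, tm k ≠ ⊤ → tm (k + 1) = ⊤ → 3 ∣ k
  status_empty : ∀ i : ℕ, ∀ u : ℝ, tm (3 * i) ≤ (u : EReal) → (u : EReal) < tm (3 * i + 1) →
    f u = TStat.emp
  status_coming : ∀ i : ℕ, ∀ u : ℝ, tm (3 * i + 1) ≤ (u : EReal) → (u : EReal) < tm (3 * i + 2) →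
    f u = TStat.coming
  status_cross : ∀ i : ℕ, ∀ u : ℝ, tm (3 * i + 2) ≤ (u : EReal) → (u : EReal) < tm (3 * i + 3) →
    f u = TStat.incrossing
  gap : ∀ i : ℕ, ∀ a b : ℝ, tm (3 * i + 1) = (a : EReal) → tm (3 * i + 2) = (b : EReal) →
    dmin ≤ b - a ∧ b - a ≤ dmax

/-- `SafeToOpen(t)`: every track is empty or its deadline is more than `dopen` away. -/
def SafeToOpen {Tracks : Type*} (dopen : ℝ) (trackStatus : Tracks → ℝ → TStat)
    (deadline : Tracks → ℝ → EReal) (t : ℝ) : Prop :=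
  ∀ x : Tracks, trackStatus x t = TStat.emp ∨ ((t + dopen : ℝ) : EReal) < deadline x t

/-- A regular run of the railroad-crossing evolving algebra.  `WaitTime = dmin - dclose`. -/
structure RegularRun (Tracks : Type*) (dmin dmax dopen dclose : ℝ) where
  trackStatus : Tracks → ℝ → TStat
  deadline : Tracks → ℝ → EReal
  dir : ℝ → DirV
  gate : ℝ → GateV
  /-- the right-hand value `Deadline(x, t+)` -/
  deadlinePlus : Tracks → ℝ → EReal
  /-- the right-hand value `Dir(t+)` -/
  dirPlus : ℝ → DirV
  /-- the right-hand value `GateStatus(t+)` -/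
  gatePlus : ℝ → GateV
  pwc_ts : ∀ x, PWC (trackStatus x)
  pwc_dl : ∀ x, PWC (deadline x)
  pwc_dir : PWC dir
  pwc_gate : PWC gate
  dlPlus_spec : ∀ x, ∀ t : ℝ, 0 ≤ t → RightVal (deadline x) t (deadlinePlus x t)
  dirPlus_spec : ∀ t : ℝ, 0 ≤ t → RightVal dir t (dirPlus t)
  gatePlus_spec : ∀ t : ℝ, 0 ≤ t → RightVal gate t (gatePlus t)
  dl_left : ∀ x, ∀ t : ℝ, 0 < t → LeftVal (deadline x) t (deadline x t)
  dir_left : ∀ t : ℝ, 0 < t → LeftVal dir t (dir t)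
  gate_left : ∀ t : ℝ, 0 < t → LeftVal gate t (gate t)
  trainMotion : ∀ x, ∃ tm : ℕ → EReal, TrainMotion dmin dmax (trackStatus x) tm
  dl_init : ∀ x, deadline x 0 = ⊤
  dir_init : dir 0 = DirV.opn
  gate_init : gate 0 = GateV.opened
  dl_step_coming : ∀ x, ∀ t : ℝ, 0 ≤ t → trackStatus x t = TStat.coming → deadline x t = ⊤ →
    deadlinePlus x t = ((t + (dmin - dclose) : ℝ) : EReal)
  dl_step_empty : ∀ x, ∀ t : ℝ, 0 ≤ t → trackStatus x t = TStat.emp → deadline x t ≠ ⊤ →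
    deadlinePlus x t = ⊤
  dl_step_other : ∀ x, ∀ t : ℝ, 0 ≤ t →
    ¬(trackStatus x t = TStat.coming ∧ deadline x t = ⊤) →
    ¬(trackStatus x t = TStat.emp ∧ deadline x t ≠ ⊤) →
    deadlinePlus x t = deadline x t
  dir_step_close : ∀ t : ℝ, 0 ≤ t → (∃ x, deadline x t = (t : EReal)) → dirPlus t = DirV.cls
  dir_step_open : ∀ t : ℝ, 0 ≤ t → (∀ x, deadline x t ≠ (t : EReal)) → dir t = DirV.cls →
    SafeToOpen dopen trackStatus deadline t → dirPlus t = DirV.opn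
  dir_step_other : ∀ t : ℝ, 0 ≤ t → (∀ x, deadline x t ≠ (t : EReal)) →
    ¬(dir t = DirV.cls ∧ SafeToOpen dopen trackStatus deadline t) → dirPlus t = dir t
  gate_step : ∀ t : ℝ, 0 ≤ t →
    gatePlus t = gate t ∨ (dir t = DirV.opn ∧ gatePlus t = GateV.opened) ∨
      (dir t = DirV.cls ∧ gatePlus t = GateV.closed)
  gate_close_bound : ∀ t : ℝ, 0 ≤ t →
    ¬(∀ u ∈ Set.Ioo t (t + dclose), dir u = DirV.cls ∧ gate u = GateV.opened)
  gate_open_bound : ∀ t : ℝ, 0 ≤ t →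
    ¬(∀ u ∈ Set.Ioo t (t + dopen), dir u = DirV.opn ∧ gate u = GateV.closed)

open Filter Topology

lemma rightVal_iff {Y : Type*} {f : ℝ → Y} {t : ℝ} {v : Y} :
    RightVal f t v ↔ ∀ᶠ u in 𝓝[>] t, f u = v := by
  rw [Filter.Eventually, mem_nhdsGT_iff_exists_Ioo_subset]
  constructor
  · rintro ⟨ε, hε, h⟩
    exact ⟨t + ε, by simpa using hε, fun u hu => h u hu.1 hu.2⟩
  · rintro ⟨b, hb, h⟩
    exact ⟨b - t, sub_pos.2 hb, fun u h₁ h₂ => h ⟨h₁, by linarith⟩⟩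

lemma leftVal_of_eventually {Y : Type*} {f : ℝ → Y} {t : ℝ} {v : Y} (ht : 0 < t)
    (hf : ∀ᶠ u in 𝓝[<] t, f u = v) : LeftVal f t v := by
  rw [Filter.Eventually, mem_nhdsLT_iff_exists_Ioo_subset] at hf
  obtain ⟨b, hb, h⟩ := hf
  rw [Set.mem_Iio] at hb
  refine ⟨min (t - b) t, lt_min (sub_pos.2 hb) ht, min_le_right _ _, fun u h₁ h₂ => h ⟨?_, h₂⟩⟩
  have := min_le_left (t - b) t
  linarith

/-- A partition of `[0, τ]` into open pieces of constancy of `f`. -/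
def HasPartition {Y : Type*} (f : ℝ → Y) (τ : ℝ) : Prop :=
  ∃ n : ℕ, ∃ s : ℕ → ℝ,
    s 0 = 0 ∧ s n = τ ∧ (∀ i < n, s i < s (i + 1)) ∧
    (∀ i < n, ∀ a b : ℝ, s i < a → a < b → b < s (i + 1) → f a = f b)

lemma HasPartition.zero {Y : Type*} (f : ℝ → Y) : HasPartition f 0 :=
  ⟨0, fun _ => 0, rfl, rfl, by simp, by simp⟩

lemma HasPartition.extend {Y : Type*} {f : ℝ → Y} {a b : ℝ} {v : Y} (h : HasPartition f a)
    (hab : a < b) (hf : ∀ u, a < u → u < b → f u = v) : HasPartition f b := by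
  obtain ⟨n, s, h₀, hn, hs, hc⟩ := h
  refine ⟨n + 1, fun k => if k ≤ n then s k else b, by simpa using h₀, by simp, ?_, ?_⟩
  · intro i hi
    rcases Nat.lt_succ_iff_lt_or_eq.1 hi with hi | rfl
    · simpa [hi.le, Nat.succ_le_of_lt hi] using hs i hi
    · simpa [hn] using hab
  · intro i hi p q
    rcases Nat.lt_succ_iff_lt_or_eq.1 hi with hi | rfl
    · simpa [hi.le, Nat.succ_le_of_lt hi] using hc i hi p q
    · simp only [le_refl, if_true, hn, Nat.not_succ_le_self, if_false]
      intro h₁ h₂ h₃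
      rw [hf p h₁ (h₂.trans h₃), hf q (h₁.trans h₂) h₃]

/-- A function with one-sided limiting values everywhere is piecewise constant. -/
lemma pwc_of_oneSided {Y : Type*} {f : ℝ → Y} (hr : ∀ t, 0 ≤ t → ∃ v, RightVal f t v)
    (hl : ∀ t, 0 < t → ∃ v, LeftVal f t v) : PWC f := by
  intro τ hτ
  change HasPartition f τ
  let S : Set ℝ := {t | 0 ≤ t ∧ t ≤ τ ∧ HasPartition f t}
  have h0 : (0 : ℝ) ∈ S := ⟨le_rfl, hτ.le, .zero f⟩
  have hbdd : BddAbove S := ⟨τ, fun t ht => ht.2.1⟩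
  have hT0 : 0 ≤ sSup S := le_csSup hbdd h0
  have hTτ : sSup S ≤ τ := csSup_le ⟨0, h0⟩ fun t ht => ht.2.1
  have hT : HasPartition f (sSup S) := by
    rcases hT0.eq_or_lt with h | h
    · rw [← h]
      exact .zero f
    · obtain ⟨v, ε, hε, -, hv⟩ := hl _ h
      obtain ⟨a, ha, haT⟩ := exists_lt_of_lt_csSup ⟨0, h0⟩ (sub_lt_self (sSup S) hε)
      rcases (le_csSup hbdd ha).eq_or_lt with h' | h'
      · exact h' ▸ ha.2.2
      · exact ha.2.2.extend h' fun u h₁ h₂ => hv u (haT.trans h₁) h₂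
  rcases hTτ.eq_or_lt with h | h
  · exact h ▸ hT
  · obtain ⟨v, ε, hε, hv⟩ := hr _ hT0
    have hlt : sSup S < min (sSup S + ε) τ := lt_min (by linarith) h
    have hmem : min (sSup S + ε) τ ∈ S :=
      ⟨hT0.trans hlt.le, min_le_right _ _,
        hT.extend hlt fun u h₁ h₂ => hv u h₁ (h₂.trans_le (min_le_left _ _))⟩
    exact absurd (le_csSup hbdd hmem) hlt.not_ge

/-- The behaviour of the deadline `d` of a single track with status `f`. -/
structure IsDeadline (dmin dopen dclose : ℝ) (f : ℝ → TStat) (d : ℝ → EReal) : Prop where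
  of_nonpos : ∀ t ≤ 0, d t = ⊤
  left : ∀ t, ∀ᶠ u in 𝓝[<] t, d u = d t
  right_coming : ∀ t, 0 ≤ t → f t = TStat.coming → d t = ⊤ →
    ∀ᶠ u in 𝓝[>] t, d u = ((t + (dmin - dclose) : ℝ) : EReal)
  right_empty : ∀ t, 0 ≤ t → f t = TStat.emp → ∀ᶠ u in 𝓝[>] t, d u = ⊤
  right_nonempty : ∀ t, 0 ≤ t → f t ≠ TStat.emp → d t ≠ ⊤ → ∀ᶠ u in 𝓝[>] t, d u = d t
  ne_top_of_incrossing : ∀ t, 0 ≤ t → f t = TStat.incrossing → d t ≠ ⊤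
  nonempty_right : ∀ t, 0 ≤ t → f t ≠ TStat.emp → ∀ᶠ u in 𝓝[>] t, f u ≠ TStat.emp
  after_due : ∀ s : ℝ, d s = s → ∀ u, s ≤ u → u < s + dclose → f u ≠ TStat.emp ∧ d u = s
  before_due : ∀ t u : ℝ, t ≤ u → u < t + dopen → d u = u → f t ≠ TStat.emp ∧ d t = u

namespace TrainMotion

variable {dmin dmax : ℝ} {f : ℝ → TStat} {tm : ℕ → EReal}

lemma nonneg (h : TrainMotion dmin dmax f tm) (k : ℕ) : 0 ≤ tm k :=
  h.zero ▸ h.mono (Nat.zero_le k)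

lemma coe_toReal (h : TrainMotion dmin dmax f tm) {k : ℕ} (hk : tm k ≠ ⊤) :
    ((tm k).toReal : EReal) = tm k :=
  EReal.coe_toReal hk (fun hb => by simpa [hb] using h.nonneg k)

lemma add_le (h : TrainMotion dmin dmax f tm) {i : ℕ} (hi : tm (3 * i + 1) ≠ ⊤) :
    (((tm (3 * i + 1)).toReal + dmin : ℝ) : EReal) ≤ tm (3 * i + 2) := by
  by_cases h2 : tm (3 * i + 2) = ⊤
  · simp [h2]
  · have := (h.gap i _ _ (h.coe_toReal hi).symm (h.coe_toReal h2).symm).1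
    rw [← h.coe_toReal h2, EReal.coe_le_coe_iff]
    linarith

lemma mul_le (h : TrainMotion dmin dmax f tm) (i : ℕ) :
    ((i * dmin : ℝ) : EReal) ≤ tm (3 * i) := by
  induction i with
  | zero => simpa using h.nonneg 0
  | succ i ih =>
    have h23 : tm (3 * i + 2) ≤ tm (3 * (i + 1)) := h.mono (by omega)
    by_cases h1 : tm (3 * i + 1) = ⊤
    · have : tm (3 * (i + 1)) = ⊤ := top_unique (h1 ▸ h.mono (by omega))
      simp [this]
    · refine le_trans ?_ ((h.add_le h1).trans h23)
      have h01 : ((i * dmin : ℝ) : EReal) ≤ tm (3 * i + 1) := ih.trans (h.mono (by omega))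
      rw [← h.coe_toReal h1, EReal.coe_le_coe_iff] at h01
      rw [EReal.coe_le_coe_iff]
      push_cast
      linarith

lemma exists_lt (h : TrainMotion dmin dmax f tm) (hd : 0 < dmin) (t : ℝ) :
    ∃ k, (t : EReal) < tm k := by
  obtain ⟨i, hi⟩ := exists_nat_gt (t / dmin)
  refine ⟨3 * i, lt_of_lt_of_le ?_ (h.mul_le i)⟩
  rw [EReal.coe_lt_coe_iff]
  exact (div_lt_iff₀ hd).1 hi

lemma exists_mem_Ico (h : TrainMotion dmin dmax f tm) (hd : 0 < dmin) {t : ℝ} (ht : 0 ≤ t) :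
    ∃ k, tm k ≤ t ∧ (t : EReal) < tm (k + 1) := by
  classical
  have hex := h.exists_lt hd t
  have h0 : Nat.find hex ≠ 0 := fun h0 => by
    have := Nat.find_spec hex
    rw [h0, h.zero] at this
    exact absurd (EReal.coe_nonneg.2 ht) this.not_ge
  obtain ⟨k, hk⟩ := Nat.exists_eq_succ_of_ne_zero h0
  exact ⟨k, not_lt.1 (Nat.find_min hex (by omega)), by
    simpa [hk] using Nat.find_spec hex⟩

lemma exists_mem_Ioc (h : TrainMotion dmin dmax f tm) (hd : 0 < dmin) {t : ℝ} (ht : 0 < t) :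
    ∃ k, tm k < t ∧ (t : EReal) ≤ tm (k + 1) := by
  classical
  have hex : ∃ k, (t : EReal) ≤ tm k := (h.exists_lt hd t).imp fun _ => le_of_lt
  have h0 : Nat.find hex ≠ 0 := fun h0 => by
    have := Nat.find_spec hex
    rw [h0, h.zero] at this
    exact absurd (EReal.coe_pos.2 ht) this.not_gt
  obtain ⟨k, hk⟩ := Nat.exists_eq_succ_of_ne_zero h0
  exact ⟨k, not_le.1 (Nat.find_min hex (by omega)), by
    simpa [hk] using Nat.find_spec hex⟩

end TrainMotion

open Classical in
/-- The deadline produced by the controller for a track with significant moments `tm`: a train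
that starts approaching at `a` sets it to `a + wait` until the track becomes empty again. -/
noncomputable def trackDeadline (wait : ℝ) (tm : ℕ → EReal) (t : ℝ) : EReal :=
  if h : ∃ i, tm (3 * i + 1) < t ∧ (t : EReal) ≤ tm (3 * i + 3) then
    (((tm (3 * h.choose + 1)).toReal + wait : ℝ) : EReal)
  else ⊤

lemma trackDeadline_of_mem {wait : ℝ} {tm : ℕ → EReal} (hm : Monotone tm) {t : ℝ} {i : ℕ}
    (h₁ : tm (3 * i + 1) < t) (h₂ : (t : EReal) ≤ tm (3 * i + 3)) :
    trackDeadline wait tm t = (((tm (3 * i + 1)).toReal + wait : ℝ) : EReal) := by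
  have h : ∃ i, tm (3 * i + 1) < t ∧ (t : EReal) ≤ tm (3 * i + 3) := ⟨i, h₁, h₂⟩
  have hc := h.choose_spec
  have h₃ := hm.reflect_lt (h₁.trans_le hc.2)
  have h₄ := hm.reflect_lt (hc.1.trans_le h₂)
  have : h.choose = i := by omega
  rw [trackDeadline, dif_pos h, this]

lemma trackDeadline_of_le {wait : ℝ} {tm : ℕ → EReal} (hm : Monotone tm) {t : ℝ} {i : ℕ}
    (h₁ : tm (3 * i) < t) (h₂ : (t : EReal) ≤ tm (3 * i + 1)) :
    trackDeadline wait tm t = ⊤ := by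
  refine dif_neg ?_
  rintro ⟨j, h₃, h₄⟩
  have := hm.reflect_lt (h₁.trans_le h₄)
  have := hm.reflect_lt (h₃.trans_le h₂)
  omega

lemma trackDeadline_eq_coe {wait : ℝ} {tm : ℕ → EReal} {t v : ℝ}
    (h : trackDeadline wait tm t = v) :
    ∃ i, tm (3 * i + 1) < t ∧ (t : EReal) ≤ tm (3 * i + 3) ∧
      (tm (3 * i + 1)).toReal + wait = v := by
  unfold trackDeadline at h
  split_ifs at h with hex
  · exact ⟨_, hex.choose_spec.1, hex.choose_spec.2, EReal.coe_eq_coe_iff.1 h⟩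
  · exact absurd h.symm (EReal.coe_ne_top _)

lemma eventually_coe_lt {t : ℝ} {c : EReal} (h : (t : EReal) < c) :
    ∀ᶠ u : ℝ in 𝓝[>] t, (u : EReal) < c :=
  (continuous_coe_real_ereal.tendsto t).eventually_lt_const h |>.filter_mono nhdsWithin_le_nhds

lemma eventually_lt_coe {t : ℝ} {c : EReal} (h : c < (t : EReal)) :
    ∀ᶠ u : ℝ in 𝓝[<] t, c < (u : EReal) :=
  (continuous_coe_real_ereal.tendsto t).eventually_const_lt h |>.filter_mono nhdsWithin_le_nhds

lemma exists_eq_three_mul_add (k : ℕ) : ∃ i, k = 3 * i ∨ k = 3 * i + 1 ∨ k = 3 * i + 2 :=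
  ⟨k / 3, by omega⟩

theorem TrainMotion.isDeadline {dmin dmax dopen dclose : ℝ} {f : ℝ → TStat} {tm : ℕ → EReal}
    (h : TrainMotion dmin dmax f tm) (hdmin : 0 < dmin) (hdclose : 0 < dclose)
    (hWT : dclose + dopen ≤ dmin) :
    IsDeadline dmin dopen dclose f (trackDeadline (dmin - dclose) tm) := by
  have hm := h.mono
  have hnonpos : ∀ t ≤ 0, trackDeadline (dmin - dclose) tm t = ⊤ := by
    intro t ht
    refine dif_neg ?_
    rintro ⟨i, hi, -⟩
    exact absurd ((h.nonneg _).trans_lt hi) (not_lt.2 (EReal.coe_nonpos.2 ht))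
  have hat : ∀ i (t : ℝ), tm (3 * i + 1) = t → trackDeadline (dmin - dclose) tm t = ⊤ := by
    intro i t ht
    refine trackDeadline_of_le hm (i := i) ?_ ht.ge
    rw [← ht]
    refine h.strict _ fun htop => ?_
    exact EReal.coe_ne_top t (ht ▸ top_unique (htop ▸ hm (Nat.le_succ _)))
  have hright : ∀ i (t : ℝ), tm (3 * i + 1) ≤ t → (t : EReal) < tm (3 * i + 3) →
      ∀ᶠ u in 𝓝[>] t, trackDeadline (dmin - dclose) tm u =
        (((tm (3 * i + 1)).toReal + (dmin - dclose) : ℝ) : EReal) := by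
    intro i t h₁ h₂
    filter_upwards [eventually_coe_lt h₂, self_mem_nhdsWithin] with u hu htu
    exact trackDeadline_of_mem hm (h₁.trans_lt (EReal.coe_lt_coe_iff.2 htu)) hu.le
  have hcases : ∀ t : ℝ, 0 ≤ t →
      (∃ i, f t = TStat.emp ∧ tm (3 * i) ≤ t ∧ (t : EReal) < tm (3 * i + 1)) ∨
      (∃ i, f t = TStat.coming ∧ tm (3 * i + 1) ≤ t ∧ (t : EReal) < tm (3 * i + 2)) ∨
      (∃ i, f t = TStat.incrossing ∧ tm (3 * i + 2) ≤ t ∧ (t : EReal) < tm (3 * i + 3)) := by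
    intro t ht
    obtain ⟨k, h₁, h₂⟩ := h.exists_mem_Ico hdmin ht
    obtain ⟨i, rfl | rfl | rfl⟩ := exists_eq_three_mul_add k
    · exact .inl ⟨i, h.status_empty i t h₁ h₂, h₁, h₂⟩
    · exact .inr (.inl ⟨i, h.status_coming i t h₁ h₂, h₁, h₂⟩)
    · exact .inr (.inr ⟨i, h.status_cross i t h₁ h₂, h₁, h₂⟩)
  have hbusy : ∀ t : ℝ, 0 ≤ t → f t ≠ TStat.emp →
      ∃ i, tm (3 * i + 1) ≤ t ∧ (t : EReal) < tm (3 * i + 3) := by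
    intro t ht hf
    obtain ⟨i, hi, -⟩ | ⟨i, -, h₁, h₂⟩ | ⟨i, -, h₁, h₂⟩ := hcases t ht
    · exact absurd hi hf
    · exact ⟨i, h₁, h₂.trans_le (hm (by omega))⟩
    · exact ⟨i, (hm (by omega)).trans h₁, h₂⟩
  refine ⟨hnonpos, ?_, ?_, ?_, ?_, ?_, ?_, ?_, ?_⟩
  · intro t
    rcases le_or_gt t 0 with ht | ht
    · filter_upwards [self_mem_nhdsWithin] with u hu
      rw [hnonpos t ht, hnonpos u (le_of_lt (lt_of_lt_of_le hu ht))]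
    · obtain ⟨k, h₁, h₂⟩ := h.exists_mem_Ioc hdmin ht
      filter_upwards [eventually_lt_coe h₁, self_mem_nhdsWithin] with u hu hut
      have h₃ := (EReal.coe_lt_coe_iff.2 hut).le.trans h₂
      obtain ⟨i, rfl | hk⟩ := exists_eq_three_mul_add k
      · rw [trackDeadline_of_le hm h₁ h₂, trackDeadline_of_le hm hu h₃]
      · have ha : tm (3 * i + 1) ≤ tm k := hm (by omega)
        have hb : tm (k + 1) ≤ tm (3 * i + 3) := hm (by omega)
        rw [trackDeadline_of_mem hm (ha.trans_lt h₁) (h₂.trans hb),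
          trackDeadline_of_mem hm (ha.trans_lt hu) (h₃.trans hb)]
  · intro t ht hf hd
    obtain ⟨i, h₁, h₂⟩ := hbusy t ht (by simp [hf])
    rcases h₁.eq_or_lt with h₃ | h₃
    · simpa [h₃] using hright i t h₁ h₂
    · rw [trackDeadline_of_mem hm h₃ h₂.le] at hd
      exact absurd hd (EReal.coe_ne_top _)
  · intro t ht hf
    obtain ⟨i, -, h₁, h₂⟩ | ⟨i, hi, -⟩ | ⟨i, hi, -⟩ := hcases t ht
    · filter_upwards [eventually_coe_lt h₂, self_mem_nhdsWithin] with u hu htu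
      exact trackDeadline_of_le hm (h₁.trans_lt (EReal.coe_lt_coe_iff.2 htu)) hu.le
    · simp [hf] at hi
    · simp [hf] at hi
  · intro t ht hf hd
    obtain ⟨i, h₁, h₂⟩ := hbusy t ht hf
    rcases h₁.eq_or_lt with h₃ | h₃
    · exact absurd (hat i t h₃) hd
    · rw [trackDeadline_of_mem hm h₃ h₂.le]
      exact hright i t h₁ h₂
  · intro t ht hf
    obtain ⟨i, hi, -⟩ | ⟨i, hi, -⟩ | ⟨i, -, h₁, h₂⟩ := hcases t ht
    · simp [hf] at hi
    · simp [hf] at hi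
    · have h₃ : tm (3 * i + 1) < tm (3 * i + 2) := h.strict _ fun htop =>
        EReal.coe_ne_top t (top_unique (htop ▸ (hm (Nat.le_succ _)).trans h₁))
      rw [trackDeadline_of_mem hm (h₃.trans_le h₁) h₂.le]
      exact EReal.coe_ne_top _
  · intro t ht hf
    obtain ⟨i, hi, -⟩ | ⟨i, -, h₁, h₂⟩ | ⟨i, -, h₁, h₂⟩ := hcases t ht
    · exact absurd hi hf
    · filter_upwards [eventually_coe_lt h₂, self_mem_nhdsWithin] with u hu htu
      simp [h.status_coming i u (h₁.trans (EReal.coe_lt_coe_iff.2 htu).le) hu]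
    · filter_upwards [eventually_coe_lt h₂, self_mem_nhdsWithin] with u hu htu
      simp [h.status_cross i u (h₁.trans (EReal.coe_lt_coe_iff.2 htu).le) hu]
  · intro s hs u hsu hus
    obtain ⟨i, h₁, -, h₃⟩ := trackDeadline_eq_coe hs
    have h₄ : (u : EReal) < tm (3 * i + 2) :=
      lt_of_lt_of_le (EReal.coe_lt_coe_iff.2 (by linarith)) (h.add_le h₁.ne_top)
    have h₅ := h₁.trans_le (EReal.coe_le_coe_iff.2 hsu)
    refine ⟨by simp [h.status_coming i u h₅.le h₄], ?_⟩
    rw [trackDeadline_of_mem hm h₅ (h₄.le.trans (hm (by omega))), h₃]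
  · intro t u htu hut hu
    obtain ⟨i, h₁, -, h₃⟩ := trackDeadline_eq_coe hu
    have h₄ : (t : EReal) < tm (3 * i + 2) :=
      lt_of_lt_of_le (EReal.coe_lt_coe_iff.2 (by linarith)) (h.add_le h₁.ne_top)
    have h₅ : tm (3 * i + 1) < t := by
      rw [← h.coe_toReal h₁.ne_top, EReal.coe_lt_coe_iff]
      linarith
    refine ⟨by simp [h.status_coming i t h₅.le h₄], ?_⟩
    rw [trackDeadline_of_mem hm h₅ (h₄.le.trans (hm (by omega))), h₃]

/-- Some deadline falls due at time `t`. -/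
def IsDue {Tracks : Type*} (d : Tracks → ℝ → EReal) (t : ℝ) : Prop :=
  ∃ x, d x t = t

open Classical in
/-- The controller's direction: `close` after a deadline has fallen due, for as long as it has not
been safe to open since then. -/
noncomputable def controllerDir {Tracks : Type*} (dopen : ℝ) (f : Tracks → ℝ → TStat)
    (d : Tracks → ℝ → EReal) (t : ℝ) : DirV :=
  if ∃ s < t, IsDue d s ∧ ∀ u, s < u → u < t → ¬SafeToOpen dopen f d u then .cls else .opn

open Classical in
/-- The right-hand value of `controllerDir`. -/
noncomputable def controllerDirPlus {Tracks : Type*} (dopen : ℝ) (f : Tracks → ℝ → TStat)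
    (d : Tracks → ℝ → EReal) (t : ℝ) : DirV :=
  if IsDue d t then .cls
  else if controllerDir dopen f d t = .cls ∧ SafeToOpen dopen f d t then .opn
  else controllerDir dopen f d t

open Classical in
/-- The right-hand value of a deadline. -/
noncomputable def deadlineRight (wait : ℝ) (f : ℝ → TStat) (d : ℝ → EReal) (t : ℝ) : EReal :=
  if f t = .coming ∧ d t = ⊤ then ((t + wait : ℝ) : EReal)
  else if f t = .emp ∧ d t ≠ ⊤ then ⊤ else d t

lemma DirV.ne_cls {v : DirV} : v ≠ .cls ↔ v = .opn := by
  cases v <;> simp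

lemma IsDeadline.eventually_right {dmin dopen dclose : ℝ} {f : ℝ → TStat} {d : ℝ → EReal}
    (h : IsDeadline dmin dopen dclose f d) {t : ℝ} (ht : 0 ≤ t) :
    ∀ᶠ u in 𝓝[>] t, d u = deadlineRight (dmin - dclose) f d t := by
  unfold deadlineRight
  split_ifs with h₁ h₂
  · exact h.right_coming t ht h₁.1 h₁.2
  · exact h.right_empty t ht h₂.1
  · by_cases hd : d t = ⊤
    · cases hf : f t with
      | emp => exact hd ▸ h.right_empty t ht hf
      | coming => exact absurd ⟨hf, hd⟩ h₁
      | incrossing => exact absurd hd (h.ne_top_of_incrossing t ht hf)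
    · exact h.right_nonempty t ht (fun hf => h₂ ⟨hf, hd⟩) hd

lemma eventually_gt_ne_coe {d : ℝ → EReal} {t : ℝ} {v : EReal}
    (h : ∀ᶠ u in 𝓝[>] t, d u = v) : ∀ᶠ u : ℝ in 𝓝[>] t, d u ≠ u := by
  rcases le_or_gt v t with hv | hv
  · filter_upwards [h, self_mem_nhdsWithin] with u hu htu
    rw [hu]
    exact (hv.trans_lt (EReal.coe_lt_coe_iff.2 htu)).ne
  · filter_upwards [h, eventually_coe_lt hv] with u hu huv
    rw [hu]
    exact huv.ne'

lemma eventually_lt_ne_coe {d : ℝ → EReal} {t : ℝ} {v : EReal}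
    (h : ∀ᶠ u in 𝓝[<] t, d u = v) : ∀ᶠ u : ℝ in 𝓝[<] t, d u ≠ u := by
  rcases le_or_gt (t : EReal) v with hv | hv
  · filter_upwards [h, self_mem_nhdsWithin] with u hu htu
    rw [hu]
    exact ((EReal.coe_lt_coe_iff.2 htu).trans_le hv).ne'
  · filter_upwards [h, eventually_lt_coe hv] with u hu huv
    rw [hu]
    exact huv.ne

section Controller

variable {Tracks : Type*} {dmin dopen dclose : ℝ} {f : Tracks → ℝ → TStat}
  {d : Tracks → ℝ → EReal}

lemma controllerDir_eq_cls {t : ℝ} : controllerDir dopen f d t = .cls ↔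
    ∃ s < t, IsDue d s ∧ ∀ u, s < u → u < t → ¬SafeToOpen dopen f d u := by
  simp [controllerDir]

lemma IsDue.pos (h : ∀ x, IsDeadline dmin dopen dclose (f x) (d x)) {t : ℝ} (ht : IsDue d t) :
    0 < t := by
  obtain ⟨x, hx⟩ := ht
  by_contra! h0
  exact EReal.coe_ne_top t (hx ▸ (h x).of_nonpos t h0)

lemma controllerDir_of_nonpos (h : ∀ x, IsDeadline dmin dopen dclose (f x) (d x)) {t : ℝ}
    (ht : t ≤ 0) : controllerDir dopen f d t = .opn := by
  rw [← DirV.ne_cls, Ne, controllerDir_eq_cls]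
  rintro ⟨s, hs, hd, -⟩
  linarith [hd.pos h]

lemma not_safeToOpen_of_due (h : ∀ x, IsDeadline dmin dopen dclose (f x) (d x))
    (hdopen : 0 < dopen) {s u : ℝ} (hs : IsDue d s) (hsu : s ≤ u) (hus : u < s + dclose) :
    ¬SafeToOpen dopen f d u := by
  obtain ⟨x, hx⟩ := hs
  obtain ⟨h₁, h₂⟩ := (h x).after_due s hx u hsu hus
  intro hsafe
  rcases hsafe x with h₃ | h₃
  · exact h₁ h₃
  · rw [h₂, EReal.coe_lt_coe_iff] at h₃
    linarith

lemma not_isDue_of_safeToOpen (h : ∀ x, IsDeadline dmin dopen dclose (f x) (d x)) {t u : ℝ}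
    (ht : SafeToOpen dopen f d t) (htu : t ≤ u) (hut : u < t + dopen) : ¬IsDue d u := by
  rintro ⟨x, hx⟩
  obtain ⟨h₁, h₂⟩ := (h x).before_due t u htu hut hx
  rcases ht x with h₃ | h₃
  · exact h₁ h₃
  · rw [h₂, EReal.coe_lt_coe_iff] at h₃
    linarith

lemma eventually_not_safeToOpen (h : ∀ x, IsDeadline dmin dopen dclose (f x) (d x)) {t : ℝ}
    (ht : 0 ≤ t) (hs : ¬SafeToOpen dopen f d t) : ∀ᶠ u in 𝓝[>] t, ¬SafeToOpen dopen f d u := by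
  simp only [SafeToOpen, not_forall, not_or, not_lt] at hs
  obtain ⟨x, h₁, h₂⟩ := hs
  have hne : d x t ≠ ⊤ := (h₂.trans_lt (EReal.coe_lt_top _)).ne
  filter_upwards [(h x).nonempty_right t ht h₁, (h x).right_nonempty t ht h₁ hne,
    self_mem_nhdsWithin] with u hu₁ hu₂ htu hsafe
  rcases hsafe x with h₃ | h₃
  · exact hu₁ h₃
  · rw [hu₂] at h₃
    have := EReal.coe_lt_coe_iff.1 (h₃.trans_le h₂)
    rw [Set.mem_Ioi] at htu
    linarith

lemma controllerDir_of_due (h : ∀ x, IsDeadline dmin dopen dclose (f x) (d x))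
    (hdopen : 0 < dopen) {s u : ℝ} (hs : IsDue d s) (hsu : s < u) (hus : u ≤ s + dclose) :
    controllerDir dopen f d u = .cls :=
  controllerDir_eq_cls.2 ⟨s, hsu, hs, fun _ h₁ h₂ =>
    not_safeToOpen_of_due h hdopen hs h₁.le (h₂.trans_le hus)⟩

lemma controllerDir_of_safeToOpen (h : ∀ x, IsDeadline dmin dopen dclose (f x) (d x)) {t u : ℝ}
    (ht : SafeToOpen dopen f d t) (htu : t < u) (hut : u ≤ t + dopen) :
    controllerDir dopen f d u = .opn := by
  rw [← DirV.ne_cls, Ne, controllerDir_eq_cls]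
  rintro ⟨s, hsu, hs, hns⟩
  rcases lt_or_ge s t with hst | hst
  · exact hns t hst htu ht
  · exact not_isDue_of_safeToOpen h ht hst (hsu.trans_le hut) hs

lemma eventually_gt_not_isDue [Finite Tracks]
    (h : ∀ x, IsDeadline dmin dopen dclose (f x) (d x)) {t : ℝ} (ht : 0 ≤ t) :
    ∀ᶠ u in 𝓝[>] t, ¬IsDue d u := by
  simp only [IsDue, not_exists]
  exact eventually_all.2 fun x => eventually_gt_ne_coe ((h x).eventually_right ht)

lemma eventually_lt_not_isDue [Finite Tracks]
    (h : ∀ x, IsDeadline dmin dopen dclose (f x) (d x)) (t : ℝ) :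
    ∀ᶠ u in 𝓝[<] t, ¬IsDue d u := by
  simp only [IsDue, not_exists]
  exact eventually_all.2 fun x => eventually_lt_ne_coe ((h x).left t)

lemma controllerDir_left [Finite Tracks] (h : ∀ x, IsDeadline dmin dopen dclose (f x) (d x))
    (t : ℝ) : ∀ᶠ u in 𝓝[<] t, controllerDir dopen f d u = controllerDir dopen f d t := by
  by_cases hc : controllerDir dopen f d t = .cls
  · obtain ⟨s, hst, hs, hns⟩ := controllerDir_eq_cls.1 hc
    filter_upwards [Ioo_mem_nhdsLT hst] with u hu
    rw [hc]
    exact controllerDir_eq_cls.2 ⟨s, hu.1, hs, fun v h₁ h₂ => hns v h₁ (h₂.trans hu.2)⟩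
  · obtain ⟨b, hb, hbt⟩ := mem_nhdsLT_iff_exists_Ioo_subset.1 (eventually_lt_not_isDue h t)
    rw [DirV.ne_cls.1 hc]
    by_cases hall : ∀ u ∈ Set.Ioo b t, controllerDir dopen f d u = .opn
    · filter_upwards [Ioo_mem_nhdsLT hb] with u hu using hall u hu
    push Not at hall
    obtain ⟨w, hw, hwc⟩ := hall
    rw [Ne, ← DirV.ne_cls, not_not, controllerDir_eq_cls] at hwc
    obtain ⟨s, hsw, hs, hns⟩ := hwc
    rw [controllerDir_eq_cls] at hc
    push Not at hc
    obtain ⟨v, hsv, hvt, hv⟩ := hc s (hsw.trans hw.2) hs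
    have hwv : w ≤ v := not_lt.1 fun hvw => hns v hsv hvw hv
    filter_upwards [Ioo_mem_nhdsLT hvt] with u hu
    rw [← DirV.ne_cls, Ne, controllerDir_eq_cls]
    rintro ⟨r, hru, hr, hnr⟩
    have hrb : r ≤ b := not_lt.1 fun hbr => hbt ⟨hbr, hru.trans hu.2⟩ hr
    exact hnr v (hrb.trans_lt (hw.1.trans_le hwv)) hu.1 hv

lemma controllerDir_right [Finite Tracks] (h : ∀ x, IsDeadline dmin dopen dclose (f x) (d x))
    (hdopen : 0 < dopen) (hdclose : 0 < dclose) (t : ℝ) :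
    ∀ᶠ u in 𝓝[>] t, controllerDir dopen f d u = controllerDirPlus dopen f d t := by
  unfold controllerDirPlus
  split_ifs with h₁ h₂
  · filter_upwards [Ioo_mem_nhdsGT (lt_add_of_pos_right t hdclose)] with u hu
    exact controllerDir_of_due h hdopen h₁ hu.1 hu.2.le
  · filter_upwards [Ioo_mem_nhdsGT (lt_add_of_pos_right t hdopen)] with u hu
    exact controllerDir_of_safeToOpen h h₂.2 hu.1 hu.2.le
  · rcases lt_or_ge t 0 with ht | ht
    · filter_upwards [Ioo_mem_nhdsGT ht] with u hu
      rw [controllerDir_of_nonpos h ht.le, controllerDir_of_nonpos h hu.2.le]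
    by_cases hc : controllerDir dopen f d t = .cls
    · have hsafe : ¬SafeToOpen dopen f d t := fun hs => h₂ ⟨hc, hs⟩
      obtain ⟨s, hst, hs, hns⟩ := controllerDir_eq_cls.1 hc
      obtain ⟨b, hb, hbt⟩ :=
        mem_nhdsGT_iff_exists_Ioo_subset.1 (eventually_not_safeToOpen h ht hsafe)
      filter_upwards [Ioo_mem_nhdsGT hb] with u hu
      rw [hc]
      refine controllerDir_eq_cls.2 ⟨s, hst.trans hu.1, hs, fun v h₃ h₄ => ?_⟩
      rcases lt_trichotomy v t with hv | rfl | hv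
      · exact hns v h₃ hv
      · exact hsafe
      · exact hbt ⟨hv, h₄.trans hu.2⟩
    · obtain ⟨b, hb, hbt⟩ := mem_nhdsGT_iff_exists_Ioo_subset.1 (eventually_gt_not_isDue h ht)
      filter_upwards [Ioo_mem_nhdsGT hb] with u hu
      rw [DirV.ne_cls.1 hc, ← DirV.ne_cls, Ne, controllerDir_eq_cls]
      rintro ⟨s, hsu, hs, hns⟩
      refine hc (controllerDir_eq_cls.2 ?_)
      rcases lt_trichotomy s t with hst | rfl | hst
      · exact ⟨s, hst, hs, fun v h₃ h₄ => hns v h₃ (h₄.trans hu.1)⟩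
      · exact absurd hs h₁
      · exact absurd hs (hbt ⟨hst, hsu.trans hu.2⟩)

/-- A change of direction persists for any delay shorter than both `dopen` and `dclose`. -/
lemma controllerDirPlus_eq_or (h : ∀ x, IsDeadline dmin dopen dclose (f x) (d x))
    (hdopen : 0 < dopen) {δ : ℝ} (hδ : 0 < δ) (hδo : δ ≤ dopen) (hδc : δ ≤ dclose) (t : ℝ) :
    controllerDirPlus dopen f d t = controllerDir dopen f d t ∨
      controllerDirPlus dopen f d t = controllerDir dopen f d (t + δ) := by
  unfold controllerDirPlus
  split_ifs with h₁ h₂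
  · exact .inr (controllerDir_of_due h hdopen h₁ (by linarith) (by linarith)).symm
  · exact .inr (controllerDir_of_safeToOpen h h₂.2 (by linarith) (by linarith)).symm
  · exact .inl rfl

end Controller

/-- The gate position commanded by a direction. -/
def DirV.target : DirV → GateV
  | .opn => .opened
  | .cls => .closed

theorem existence_theorem {Tracks : Type*} [Fintype Tracks] [Nonempty Tracks]
    {dmin dmax dopen dclose : ℝ}
    (hdmin : 0 < dmin) (hdmax : 0 < dmax) (hdopen : 0 < dopen) (hdclose : 0 < dclose)
    (hcm : dclose < dmin) (hmm : dmin ≤ dmax)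
    (hWT : dclose + dopen ≤ dmin)
    (trackStatus : Tracks → ℝ → TStat)
    (hpwc : ∀ x, PWC (trackStatus x))
    (htm : ∀ x, ∃ tm : ℕ → EReal, TrainMotion dmin dmax (trackStatus x) tm) :
    ∃ R : RegularRun Tracks dmin dmax dopen dclose, R.trackStatus = trackStatus := by
  choose tm htm' using htm
  set d : Tracks → ℝ → EReal := fun x => trackDeadline (dmin - dclose) (tm x)
  have h : ∀ x, IsDeadline dmin dopen dclose (trackStatus x) (d x) := fun x =>
    (htm' x).isDeadline hdmin hdclose hWT
  obtain ⟨δ, hδ, hδo, hδc⟩ : ∃ δ, 0 < δ ∧ 2 * δ ≤ dopen ∧ 2 * δ ≤ dclose :=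
    ⟨min dopen dclose / 2, half_pos (lt_min hdopen hdclose),
      by linarith [min_le_left dopen dclose], by linarith [min_le_right dopen dclose]⟩
  set dir := controllerDir dopen trackStatus d
  set dirPlus := controllerDirPlus dopen trackStatus d with hdirPlus
  have hdlR : ∀ x t, 0 ≤ t →
      RightVal (d x) t (deadlineRight (dmin - dclose) (trackStatus x) (d x) t) :=
    fun x t ht => rightVal_iff.2 ((h x).eventually_right ht)
  have hdlL : ∀ x t, 0 < t → LeftVal (d x) t (d x t) :=
    fun x t ht => leftVal_of_eventually ht ((h x).left t)
  have hdirR : ∀ t, RightVal dir t (dirPlus t) :=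
    fun t => rightVal_iff.2 (controllerDir_right h hdopen hdclose t)
  have hdirL : ∀ t, 0 < t → LeftVal dir t (dir t) :=
    fun t ht => leftVal_of_eventually ht (controllerDir_left h t)
  have hgateR : ∀ t, RightVal (fun t => (dir (t - δ)).target) t (dirPlus (t - δ)).target := by
    intro t
    obtain ⟨ε, hε, hu⟩ := hdirR (t - δ)
    exact ⟨ε, hε, fun u h₁ h₂ => congrArg _ (hu _ (by linarith) (by linarith))⟩
  have hgateL : ∀ t, 0 < t →
      LeftVal (fun t => (dir (t - δ)).target) t (dir (t - δ)).target := by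
    intro t ht
    obtain ⟨b, hb, hbt⟩ := mem_nhdsLT_iff_exists_Ioo_subset.1 (controllerDir_left h (t - δ))
    rw [Set.mem_Iio] at hb
    refine leftVal_of_eventually ht ?_
    filter_upwards [Ioo_mem_nhdsLT (show b + δ < t by linarith)] with u hu
    exact congrArg _ (hbt ⟨by linarith [hu.1], by linarith [hu.2]⟩)
  refine ⟨{
    trackStatus := trackStatus
    deadline := d
    dir := dir
    gate := fun t => (dir (t - δ)).target
    deadlinePlus := fun x => deadlineRight (dmin - dclose) (trackStatus x) (d x)
    dirPlus := dirPlus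
    gatePlus := fun t => (dirPlus (t - δ)).target
    pwc_ts := hpwc
    pwc_dl := fun x =>
      pwc_of_oneSided (fun t ht => ⟨_, hdlR x t ht⟩) fun t ht => ⟨_, hdlL x t ht⟩
    pwc_dir := pwc_of_oneSided (fun t _ => ⟨_, hdirR t⟩) fun t ht => ⟨_, hdirL t ht⟩
    pwc_gate := pwc_of_oneSided (fun t _ => ⟨_, hgateR t⟩) fun t ht => ⟨_, hgateL t ht⟩
    dlPlus_spec := hdlR
    dirPlus_spec := fun t _ => hdirR t
    gatePlus_spec := fun t _ => hgateR t
    dl_left := hdlL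
    dir_left := hdirL
    gate_left := hgateL
    trainMotion := fun x => ⟨tm x, htm' x⟩
    dl_init := fun x => (h x).of_nonpos 0 le_rfl
    dir_init := controllerDir_of_nonpos h le_rfl
    gate_init := congrArg DirV.target (controllerDir_of_nonpos h (by linarith))
    dl_step_coming := fun x t _ h₁ h₂ => if_pos ⟨h₁, h₂⟩
    dl_step_empty := fun x t _ h₁ h₂ => by simp [deadlineRight, h₁, h₂]
    dl_step_other := fun x t _ h₁ h₂ => by rw [deadlineRight, if_neg h₁, if_neg h₂]
    dir_step_close := fun t _ hx => if_pos hx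
    dir_step_open := fun t _ hx hc hs => by
      rw [hdirPlus, controllerDirPlus, if_neg (show ¬IsDue d t from not_exists.2 hx), if_pos ⟨hc, hs⟩]
    dir_step_other := fun t _ hx hc => by
      rw [hdirPlus, controllerDirPlus, if_neg (show ¬IsDue d t from not_exists.2 hx), if_neg hc]
    gate_step := ?_
    gate_close_bound := ?_
    gate_open_bound := ?_ }, rfl⟩
  · intro t _
    rcases controllerDirPlus_eq_or h hdopen hδ (by linarith) (by linarith) (t - δ) with h₁ | h₁
    · exact .inl (congrArg _ h₁)
    · rw [sub_add_cancel] at h₁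
      right
      rw [show dirPlus (t - δ) = dir t from h₁]
      cases dir t <;> simp [DirV.target]
  · intro t _ hall
    have h₁ := (hall (t + δ / 2) ⟨by linarith, by linarith⟩).1
    have h₂ := (hall (t + δ / 2 + δ) ⟨by linarith, by linarith⟩).2
    simp only [add_sub_cancel_right, h₁, DirV.target, reduceCtorEq] at h₂
  · intro t _ hall
    have h₁ := (hall (t + δ / 2) ⟨by linarith, by linarith⟩).1
    have h₂ := (hall (t + δ / 2 + δ) ⟨by linarith, by linarith⟩).2
    simp only [add_sub_cancel_right, h₁, DirV.target, reduceCtorEq] at h₂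

end RailCross
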